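/- Let T be a finite tree of order n rooted at a vertex r. Then α_b(T) = β((r, d_T(r)), (−1, n), (n, 1)), where d_T(r) is the number of children of r (that is, T(r, d_T(r)) = T). -/

import Mathlib

/-- The function `g_{(p,q)} : ℤ → ℤ` with `g_{(p,q)}(d) = 0` if `d ≤ p` and
`g_{(p,q)}(d) = d - p + q - 1` if `d ≥ p + 1`. -/
def gfun (p q d : ℤ) : ℤ := if d ≤ p then 0 else d - p + q - 1

/-- The eccentricity of a vertex `x`: the maximum distance from `x` to any vertex. -/
noncomputable def ecc {V : Type*} (G : SimpleGraph V) (x : V) : ℕ := ⨆ y, G.dist x y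

/-- In the tree `T` rooted at `r`, the vertex `y` is a descendant of `v`, that is,
`v` lies on the path from `r` to `y`. -/
def IsDesc {V : Type*} (T : SimpleGraph V) (r v y : V) : Prop :=
  T.dist r y = T.dist r v + T.dist v y

/-- The vertex set `V(u,i)` of the subtree `T(u,i)` of the tree `T` rooted at `r`:
it consists of `u` together with all descendants of the first `i` children
`c 0, ..., c (i-1)` of `u` (in the fixed linear order `c` on the children of `u`). -/
def subtreeSet {V : Type*} (T : SimpleGraph V) (r u : V) {k : ℕ} (c : Fin k → V)
    (i : ℕ) : Set V :=
  {u} ∪ {y | ∃ j : Fin k, (j : ℕ) < i ∧ IsDesc T r (c j) y}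

/-- A function `f` on the vertex set `S = V(u0,i)` is
`((p_in,q_in),(p_out,q_out))`-compatible (with respect to `u0`) if
(C1) `f x ≤ ecc_T(x)` on `S`;
(C2) `dist_T(x,y) > max {f x, f y}` for distinct `x, y ∈ S` with positive values;
(C3) `f x ≤ g_{(p_in,q_in)}(dist_T(u0,x))` on `S`; and
(C4) every `x ∈ S` with `f x > 0` satisfies
     `g_{(p_out,q_out)}(d) ≤ g_{(f x,f x)}(d + dist_T(u0,x))` for every `d > 0`. -/
def Compatible {V : Type*} (T : SimpleGraph V) (u0 : V) (S : Set V)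
    (pin qin pout qout : ℤ) (f : V → ℕ) : Prop :=
  (∀ x ∈ S, f x ≤ ecc T x) ∧
  (∀ x ∈ S, ∀ y ∈ S, x ≠ y → 0 < f x → 0 < f y → max (f x) (f y) < T.dist x y) ∧
  (∀ x ∈ S, (f x : ℤ) ≤ gfun pin qin (T.dist u0 x)) ∧
  (∀ x ∈ S, 0 < f x → ∀ d : ℤ, 0 < d →
    gfun pout qout d ≤ gfun (f x) (f x) (d + T.dist u0 x))

/-- An independent broadcast on `G`: `f x ≤ ecc_G(x)` for every vertex `x`, and
`dist_G(x,y) > max {f x, f y}` for distinct vertices `x, y` with `f x, f y > 0`. -/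
def IsIndepBroadcast {V : Type*} (G : SimpleGraph V) (f : V → ℕ) : Prop :=
  (∀ x, f x ≤ ecc G x) ∧
    ∀ x y, x ≠ y → 0 < f x → 0 < f y → max (f x) (f y) < G.dist x y

/-- The broadcast independence number: the maximum weight `∑ x, f x` of an
independent broadcast `f` on `G`. -/
noncomputable def broadcastIndepNum {V : Type*} [Fintype V] (G : SimpleGraph V) : ℕ :=
  sSup {w | ∃ f : V → ℕ, IsIndepBroadcast G f ∧ w = ∑ x, f x}

/-- `β((u0,S),(p_in,q_in),(p_out,q_out))`: the maximum weight `∑_{x ∈ S} f x` of a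
`((p_in,q_in),(p_out,q_out))`-compatible function `f` on `S` (extended by zero outside
of `S`). -/
noncomputable def beta {V : Type*} [Fintype V] (T : SimpleGraph V) (u0 : V) (S : Set V)
    (pin qin pout qout : ℤ) : ℕ :=
  sSup {w | ∃ f : V → ℕ, (∀ x, x ∉ S → f x = 0) ∧
    Compatible T u0 S pin qin pout qout f ∧ w = ∑ x, f x}

/-- Every eccentricity in a finite connected graph is smaller than the order of the graph. -/
theorem ecc_lt_card {V : Type*} [Fintype V] {G : SimpleGraph V} (hG : G.Connected) (x : V) :
    ecc G x < Fintype.card V := by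
  have : Nonempty V := ⟨x⟩
  have hdist (y : V) : G.dist x y ≤ Fintype.card V - 1 := by
    obtain ⟨p, hp, hlen⟩ := hG.exists_path_of_dist x y
    have := hp.length_lt
    omega
  have hle : ecc G x ≤ Fintype.card V - 1 := ciSup_le hdist
  have : 0 < Fintype.card V := Fintype.card_pos
  omega

/-- On the whole vertex set, the parameters `(-1, n)` and `(n, 1)` impose no further condition
on an independent broadcast. -/
theorem compatible_univ_iff {V : Type*} [Fintype V] {G : SimpleGraph V} (hG : G.Connected)
    (r : V) (f : V → ℕ) :
    Compatible G r Set.univ (-1) (Fintype.card V : ℤ) (Fintype.card V : ℤ) 1 f ↔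
      IsIndepBroadcast G f := by
  constructor
  · rintro ⟨h₁, h₂, -, -⟩
    exact ⟨fun x => h₁ x trivial, fun x y => h₂ x trivial y trivial⟩
  · rintro ⟨h₁, h₂⟩
    have hlt (x : V) : f x < Fintype.card V := (h₁ x).trans_lt (ecc_lt_card hG x)
    refine ⟨fun x _ => h₁ x, fun x _ y _ => h₂ x y, fun x _ => ?_, fun x _ _ d _ => ?_⟩
    · have := hlt x
      unfold gfun
      split_ifs <;> omega
    · have := hlt x
      unfold gfun
      split_ifs <;> omega

/-- Lemma 3: for a tree `T` of order `n` rooted at `r`,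
`α_b(T) = β((r, d_T(r)), (-1, n), (n, 1))`, where `T(r, d_T(r)) = T`, that is, the
relevant vertex set is the whole vertex set of `T`. -/
theorem stmt14 {V : Type*} [Fintype V] (T : SimpleGraph V) (hT : T.IsTree)
    (n : ℕ) (hn : n = Fintype.card V) (r : V) :
    broadcastIndepNum T = beta T r Set.univ (-1) (n : ℤ) (n : ℤ) 1 := by
  subst hn
  unfold broadcastIndepNum beta
  simp [compatible_univ_iff hT.connected]
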